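/- For every integer n > 1, Ψ(n) = φ(n) + max_{p prime, p ∣ n} Ψ(n/p), where φ is Euler's totient function; that is, the closed formula Ψ satisfies this recurrence with initial value Ψ(1) = 1. -/

import Mathlib

/-- For `n = p₁^{α₁} ⋯ p_k^{α_k}` with `p₁ < ⋯ < p_k` prime,
`Ψ(n) = 1 + ∑_{r=1}^{k} (p_r^{α_r} − 1) ∏_{j=r+1}^{k} p_j^{α_j−1}(p_j − 1)`,
where the inner factor `p_j^{α_j−1}(p_j − 1)` is `φ(p_j^{α_j})`; `Ψ(1) = 1`. -/
noncomputable def Psi (n : ℕ) : ℕ :=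
  1 + ∑ p ∈ n.primeFactors,
      (p ^ (n.factorization p) - 1) *
        ∏ q ∈ n.primeFactors.filter (fun q => p < q), Nat.totient (q ^ (n.factorization q))

theorem Psi_one_aux : Psi 1 = 1 := by simp [Psi]

theorem Psi_mul_aux (m P b : ℕ) (hm : m ≠ 0) (hP : P.Prime)
    (h : ∀ q, q.Prime → q ∣ m → q < P) :
    Psi (m * P ^ b) + Nat.totient (P ^ b) = P ^ b + Nat.totient (P ^ b) * Psi m := by
  have hPm : ¬ P ∣ m := fun hd => lt_irrefl _ (h P hP hd)
  rcases Nat.eq_zero_or_pos b with rfl | hb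
  · simp [add_comm]
  have hpf : (m * P ^ b).primeFactors = insert P m.primeFactors := by
    rw [Nat.primeFactors_mul hm (pow_ne_zero _ hP.ne_zero), Nat.primeFactors_prime_pow hb.ne' hP]
    ext x; simp [or_comm]
  have hlt : ∀ q ∈ m.primeFactors, q < P := fun q hq =>
    h q (Nat.prime_of_mem_primeFactors hq) (Nat.dvd_of_mem_primeFactors hq)
  have hnot : P ∉ m.primeFactors := fun hx => lt_irrefl _ (hlt P hx)
  have hfP : (m * P ^ b).factorization P = b := by
    rw [Nat.factorization_mul hm (pow_ne_zero _ hP.ne_zero)]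
    simp [Nat.factorization_eq_zero_of_not_dvd hPm, hP.factorization_self]
  have hfq : ∀ q, q ≠ P → (m * P ^ b).factorization q = m.factorization q := by
    intro q hq
    rw [Nat.factorization_mul hm (pow_ne_zero _ hP.ne_zero)]
    simp [hP.factorization, Finsupp.single_apply, hq.symm]
  have hf1 : (insert P m.primeFactors).filter (fun q => P < q) = ∅ := by
    ext x
    simp only [Finset.mem_filter, Finset.mem_insert, Finset.notMem_empty, iff_false]
    rintro ⟨rfl | hx, h2⟩
    · exact lt_irrefl _ h2
    · exact lt_asymm h2 (hlt x hx)
  have hPb : 1 ≤ P ^ b := Nat.one_le_pow _ _ hP.pos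
  have key : Psi (m * P ^ b) = 1 + ((P ^ b - 1) + ∑ p ∈ m.primeFactors,
      Nat.totient (P ^ b) * ((p ^ (m.factorization p) - 1) *
        ∏ q ∈ m.primeFactors.filter (fun q => p < q), Nat.totient (q ^ (m.factorization q)))) := by
    unfold Psi
    rw [hpf, Finset.sum_insert hnot, hf1, hfP, Finset.prod_empty, mul_one]
    congr 2
    apply Finset.sum_congr rfl
    intro p hp
    have hpP := hlt p hp
    rw [Finset.filter_insert, if_pos hpP, Finset.prod_insert (by simp [hnot]), hfP,
      hfq p hpP.ne]
    rw [Finset.prod_congr rfl (g := fun q => Nat.totient (q ^ (m.factorization q)))]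
    · ring
    · intro q hq
      rw [hfq q (hlt q (Finset.mem_filter.1 hq).1).ne]
  rw [key, ← Finset.mul_sum]
  conv_rhs => unfold Psi
  rw [mul_add]
  omega

theorem max_prime_induction (C : ℕ → Prop) (h1 : C 1)
    (hs : ∀ m P a : ℕ, m ≠ 0 → P.Prime → (∀ q, q.Prime → q ∣ m → q < P) → C m →
      C (m * P ^ (a + 1))) : ∀ n, n ≠ 0 → C n := by
  intro n
  induction n using Nat.strong_induction_on with
  | _ n ih =>
    intro hn
    by_cases hn1 : n = 1
    · exact hn1 ▸ h1
    have hne : n.primeFactors.Nonempty := Nat.nonempty_primeFactors.2 (by omega)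
    obtain ⟨P, hPm, hmax⟩ := n.primeFactors.exists_max_image id hne
    have hP := Nat.prime_of_mem_primeFactors hPm
    obtain ⟨b, m, hnd, he⟩ := Nat.exists_eq_pow_mul_and_not_dvd hn P hP.ne_one
    have hm : m ≠ 0 := by rintro rfl; simp at hnd
    have hb : b ≠ 0 := by
      rintro rfl
      apply hnd
      have := Nat.dvd_of_mem_primeFactors hPm
      simpa [he] using this
    obtain ⟨a, rfl⟩ := Nat.exists_eq_succ_of_ne_zero hb
    have hlt : m < n := by
      rw [he]
      exact lt_mul_of_one_lt_left (Nat.pos_of_ne_zero hm) (Nat.one_lt_pow hb hP.one_lt)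
    have := hs m P a hm hP (fun q hq hqm => by
      refine lt_of_le_of_ne (hmax q ?_) ?_
      · exact Nat.mem_primeFactors.2 ⟨hq, he ▸ Dvd.dvd.mul_left hqm _, hn⟩
      · rintro rfl; exact hnd hqm) (ih m hlt hm)
    rw [he, mul_comm]; exact this

theorem coprime_aux (m P b : ℕ) (hP : P.Prime)
    (h : ∀ q, q.Prime → q ∣ m → q < P) : Nat.Coprime m (P ^ b) :=
  Nat.Coprime.pow_right _ (Nat.Coprime.symm ((Nat.Prime.coprime_iff_not_dvd hP).2
    fun hd => lt_irrefl _ (h P hP hd)))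

theorem totient_pow_aux (P a : ℕ) (hP : P.Prime) :
    (Nat.totient (P ^ (a + 1)) : ℤ) = (P : ℤ) ^ a * (P - 1) := by
  rw [Nat.totient_prime_pow_succ hP]
  push_cast [hP.one_le]
  rfl

theorem bound_aux : ∀ n, n ≠ 0 → (Nat.totient n : ℤ) ≤ Psi n ∧
    ∀ t : ℕ, 1 ≤ t → (∀ q, q.Prime → q ∣ n → q ≤ t) →
      (t : ℤ) * Nat.totient n + Psi n ≤ t * Psi n + 1 := by
  apply max_prime_induction
  · simp [Psi_one_aux]
  · intro m P a hm hP h ⟨ih1, ih2⟩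
    have hk := Psi_mul_aux m P (a + 1) hm hP h
    have hk' : (Psi (m * P ^ (a+1)) : ℤ) + Nat.totient (P ^ (a+1)) =
        (P:ℤ) ^ (a+1) + Nat.totient (P ^ (a+1)) * Psi m := by exact_mod_cast hk
    have h3 := ih2 P hP.one_le (fun q hq hd => (h q hq hd).le)
    rw [Nat.totient_mul (coprime_aux m P (a+1) hP h)]
    push_cast
    rw [totient_pow_aux P a hP] at hk' ⊢
    have hx : (1:ℤ) ≤ (P:ℤ) ^ a := by exact_mod_cast Nat.one_le_pow _ _ hP.pos
    have hP2 : (2:ℤ) ≤ P := by exact_mod_cast hP.two_le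
    rw [pow_succ (P : ℤ) a] at hk'
    generalize (P:ℤ)^a = x at *
    generalize (Psi (m * P ^ (a+1)) : ℤ) = N at *
    generalize (Psi m : ℤ) = y at *
    generalize (Nat.totient m : ℤ) = f at *
    have hN : N = x + x * (P - 1) * y := by linarith
    have hA : f * (x * (P - 1)) ≤ N := by
      have : 0 ≤ x * (P - 1) * (y - f) := 
        mul_nonneg (mul_nonneg (by linarith) (by linarith)) (by linarith)
      nlinarith
    refine ⟨hA, ?_⟩
    intro t ht hq
    have hPt : (P:ℤ) ≤ t := by
      exact_mod_cast hq P hP (Dvd.dvd.mul_left (dvd_pow_self P (by omega)) m)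
    have hB : (P:ℤ) * (f * (x * (P - 1))) + N ≤ P * N + 1 := by
      have : 0 ≤ x * (P - 1) * (P * y + 1 - P * f - y) := 
        mul_nonneg (mul_nonneg (by linarith) (by linarith)) (by linarith)
      subst hN
      nlinarith
    nlinarith [mul_nonneg (sub_nonneg.2 hPt) (sub_nonneg.2 hA)]

theorem rec_aux : ∀ n, n ≠ 0 → (∀ p ∈ n.primeFactors, Psi (n / p) + Nat.totient n ≤ Psi n) ∧
    (1 < n → ∃ p ∈ n.primeFactors, Psi (n / p) + Nat.totient n = Psi n) := by
  apply max_prime_induction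
  · simp
  · intro m P a hm hP h ⟨ih1, ih2⟩
    have hk := Psi_mul_aux m P (a + 1) hm hP h
    have hk' : (Psi (m * P ^ (a+1)) : ℤ) + Nat.totient (P ^ (a+1)) =
        (P:ℤ) ^ (a+1) + Nat.totient (P ^ (a+1)) * Psi m := by exact_mod_cast hk
    have hdivP : m * P ^ (a+1) / P = m * P ^ a := by
      rw [pow_succ, ← mul_assoc, Nat.mul_div_cancel _ hP.pos]
    have hpf : (m * P ^ (a+1)).primeFactors = insert P m.primeFactors := by
      rw [Nat.primeFactors_mul hm (pow_ne_zero _ hP.ne_zero),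
        Nat.primeFactors_prime_pow (by omega) hP]
      ext x; simp [or_comm]
    have hq : ∀ p ∈ m.primeFactors,
        (Psi (m * P ^ (a+1) / p) : ℤ) + Nat.totient (P ^ (a+1)) =
        (P:ℤ) ^ (a+1) + Nat.totient (P ^ (a+1)) * Psi (m / p) := by
      intro p hp
      have hpd := Nat.dvd_of_mem_primeFactors hp
      rw [Nat.mul_comm m, Nat.mul_div_assoc _ hpd, Nat.mul_comm]
      have := Psi_mul_aux (m / p) P (a + 1)
        (Nat.div_pos (Nat.le_of_dvd (Nat.pos_of_ne_zero hm) hpd)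
          (Nat.prime_of_mem_primeFactors hp).pos).ne' hP
        (fun q hq hd => h q hq (hd.trans (Nat.div_dvd_of_dvd hpd)))
      exact_mod_cast this
    have hpow : (1:ℤ) ≤ (P:ℤ) ^ a := by exact_mod_cast Nat.one_le_pow _ _ hP.pos
    have hP2 : (2:ℤ) ≤ P := by exact_mod_cast hP.two_le
    rw [hpf, Nat.totient_mul (coprime_aux m P (a+1) hP h)]
    constructor
    · intro p hp
      rcases Finset.mem_insert.1 hp with rfl | hp
      · rw [hdivP]
        have hl : (Psi (m * p ^ a) : ℤ) + Nat.totient (p ^ a) =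
            (p:ℤ) ^ a + Nat.totient (p ^ a) * Psi m := by
          exact_mod_cast Psi_mul_aux m p a hm hP h
        zify
        rw [totient_pow_aux p a hP] at hk' ⊢
        rcases a with _ | a
        · have h3 := (bound_aux m hm).2 (p - 1) (by have := hP.two_le; omega)
            (fun q hq hd => by have := h q hq hd; omega)
          rw [Nat.cast_sub hP.one_le] at h3
          simp at hl hk' h3 ⊢
          nlinarith
        · have h3 := (bound_aux m hm).2 p hP.one_le (fun q hq hd => (h q hq hd).le)
          rw [totient_pow_aux p a hP] at hl
          have hx : (1:ℤ) ≤ (p:ℤ) ^ a := by exact_mod_cast Nat.one_le_pow _ _ hP.pos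
          have := mul_nonneg (mul_nonneg (show (0:ℤ) ≤ (p:ℤ)^a by linarith)
            (show (0:ℤ) ≤ (p:ℤ) - 1 by linarith)) (sub_nonneg.2 h3)
          simp only [pow_succ] at hl hk' this ⊢
          nlinarith
      · have h1 := hq p hp
        have h2 : (Psi (m / p) : ℤ) + Nat.totient m ≤ Psi m := by exact_mod_cast ih1 p hp
        zify
        nlinarith [mul_le_mul_of_nonneg_left h2 (Int.natCast_nonneg (Nat.totient (P ^ (a+1))))]
    · intro _
      by_cases hm1 : m = 1
      · subst hm1
        refine ⟨P, by simp, ?_⟩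
        rw [hdivP]
        have hl : (Psi (1 * P ^ a) : ℤ) + Nat.totient (P ^ a) =
            (P:ℤ) ^ a + Nat.totient (P ^ a) * Psi 1 := by
          exact_mod_cast Psi_mul_aux 1 P a hm hP h
        zify
        rw [totient_pow_aux P a hP] at hk' ⊢
        rw [Psi_one_aux] at hl hk'
        simp only [pow_succ, Nat.totient_one] at hk' hl ⊢
        push_cast at *
        linarith
      · obtain ⟨p, hp, h2⟩ := ih2 (by omega)
        refine ⟨p, Finset.mem_insert_of_mem hp, ?_⟩
        have h1 := hq p hp
        have h2 : (Psi (m / p) : ℤ) + Nat.totient m = Psi m := by exact_mod_cast h2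
        zify
        rw [← h2] at hk'
        linarith

/-- For every `n > 1`, `Ψ(n) = φ(n) + max_{p prime, p ∣ n} Ψ(n/p)`
(the maximum ranging over the prime divisors `p` of `n`). -/
theorem Psi_recurrence (n : ℕ) (hn : 1 < n) :
    Psi n = Nat.totient n + n.primeFactors.sup (fun p => Psi (n / p)) := by
  obtain ⟨h1, h2⟩ := rec_aux n (by omega)
  obtain ⟨p, hp, he⟩ := h2 hn
  have hle : n.primeFactors.sup (fun p => Psi (n / p)) ≤ Psi n - Nat.totient n :=
    Finset.sup_le fun q hq => by have := h1 q hq; omega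
  have hge : Psi (n / p) ≤ n.primeFactors.sup (fun p => Psi (n / p)) :=
    Finset.le_sup (f := fun p => Psi (n / p)) hp
  omega
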